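/- Let z : (Fin n → Bool) → (Fin m → Bool) be any finite composite of cubical degeneracy maps σⁿᵢ and cubical connection maps γⁿᵢ,₀ and γⁿᵢ,₁ (including the empty composite, the identity). Then there exists a map s : (Fin m → Bool) → (Fin n → Bool) which is a finite composite of cubical face maps dⁿᵢ,ε such that z ∘ s = id. (This is the key step in the proof of Lemma 5.7 of the paper: every composite of degeneracies and connections in the cube category has a section consisting of face maps.) -/

import Mathlib

/-!
Every finite composite of cubical degeneracies and connections has a section which is
a finite composite of cubical face maps (the key step in Lemma 5.7 of the paper).
-/

/-- The cubical face map `d i ε : (Fin n → Bool) → (Fin (n+1) → Bool)`, inserting the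
value `ε` at position `i`. -/
def cubeFace {n : ℕ} (i : Fin (n + 1)) (ε : Bool) (x : Fin n → Bool) :
    Fin (n + 1) → Bool :=
  i.insertNth ε x

/-- The cubical degeneracy `σ i : (Fin (n+1) → Bool) → (Fin n → Bool)`, deleting the
coordinate at position `i`. -/
def cubeDegen {n : ℕ} (i : Fin (n + 1)) (x : Fin (n + 1) → Bool) : Fin n → Bool :=
  fun j => x (i.succAbove j)

/-- The cubical connection at position `i`, combining coordinates `i` and `i + 1` via
the binary operation `op` (so `op = max` gives the positive connection `γ i 0` and
`op = min` gives the negative connection `γ i 1`). -/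
def cubeConn {n : ℕ} (op : Bool → Bool → Bool) (i : Fin n) (x : Fin (n + 1) → Bool) :
    Fin n → Bool :=
  fun j =>
    if j = i then op (x i.castSucc) (x i.succ)
    else if (j : ℕ) < (i : ℕ) then x j.castSucc else x j.succ

/-- The finite composites of cubical degeneracies and connections (including the empty
composite, the identity). -/
inductive IsDegenConnComposite : {n m : ℕ} → ((Fin n → Bool) → (Fin m → Bool)) → Prop
  | id (n : ℕ) : IsDegenConnComposite (id : (Fin n → Bool) → (Fin n → Bool))
  | degen {n m : ℕ} (f : (Fin n → Bool) → (Fin m → Bool)) (i : Fin (n + 1)) :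
      IsDegenConnComposite f → IsDegenConnComposite (f ∘ cubeDegen i)
  | connPos {n m : ℕ} (f : (Fin n → Bool) → (Fin m → Bool)) (i : Fin n) :
      IsDegenConnComposite f → IsDegenConnComposite (f ∘ cubeConn max i)
  | connNeg {n m : ℕ} (f : (Fin n → Bool) → (Fin m → Bool)) (i : Fin n) :
      IsDegenConnComposite f → IsDegenConnComposite (f ∘ cubeConn min i)

/-- The finite composites of cubical face maps (including the empty composite, the
identity). -/
inductive IsFaceComposite : {n m : ℕ} → ((Fin n → Bool) → (Fin m → Bool)) → Prop
  | id (n : ℕ) : IsFaceComposite (id : (Fin n → Bool) → (Fin n → Bool))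
  | face {n m : ℕ} (f : (Fin n → Bool) → (Fin m → Bool)) (i : Fin (m + 1)) (ε : Bool) :
      IsFaceComposite f → IsFaceComposite (cubeFace i ε ∘ f)

theorem cubeDegen_comp_cubeFace {n : ℕ} (i : Fin (n + 1)) (ε : Bool) :
    cubeDegen i ∘ cubeFace i ε = id := by
  funext x j
  simp [cubeDegen, cubeFace]

theorem cubeConn_comp_cubeFace {n : ℕ} {op : Bool → Bool → Bool} {ε : Bool}
    (hop : ∀ b, op ε b = b) (i : Fin n) :
    cubeConn op i ∘ cubeFace i.castSucc ε = id := by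
  have face_succAbove (x : Fin n → Bool) (j : Fin n) :
      cubeFace i.castSucc ε x (i.castSucc.succAbove j) = x j :=
    Fin.insertNth_apply_succAbove (α := fun _ => Bool) _ _ _ _
  have face_same (x : Fin n → Bool) : cubeFace i.castSucc ε x i.castSucc = ε :=
    Fin.insertNth_apply_same (α := fun _ => Bool) _ _ _
  funext x j
  have hj := face_succAbove x j
  simp only [Function.comp_apply, cubeConn, id_eq]
  split_ifs with h₁ h₂
  · subst h₁
    rw [Fin.succAbove_castSucc_self] at hj
    rw [face_same, hop, hj]
  · rwa [Fin.succAbove_of_castSucc_lt _ _ (Fin.castSucc_lt_castSucc_iff.2 (Fin.lt_def.2 h₂))] at hj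
  · rwa [Fin.succAbove_of_le_castSucc _ _
      (Fin.castSucc_le_castSucc_iff.2 (Fin.le_def.2 (not_lt.1 h₂)))] at hj

/-- A section of `f` by faces extends along a map `g` that has a single face as section. -/
theorem exists_isFaceComposite_section_comp {n m : ℕ} {f : (Fin n → Bool) → (Fin m → Bool)}
    {g : (Fin (n + 1) → Bool) → (Fin n → Bool)} {i : Fin (n + 1)} {ε : Bool}
    (hg : g ∘ cubeFace i ε = id)
    (hf : ∃ s : (Fin m → Bool) → (Fin n → Bool), IsFaceComposite s ∧ f ∘ s = id) :
    ∃ s : (Fin m → Bool) → (Fin (n + 1) → Bool), IsFaceComposite s ∧ (f ∘ g) ∘ s = id := by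
  obtain ⟨s, hs, hfs⟩ := hf
  refine ⟨cubeFace i ε ∘ s, .face s i ε hs, ?_⟩
  calc (f ∘ g) ∘ cubeFace i ε ∘ s = f ∘ (g ∘ cubeFace i ε) ∘ s := rfl
    _ = id := by rw [hg, Function.id_comp, hfs]

/-- Every finite composite `z` of cubical degeneracies and connections admits a section
`s` which is a finite composite of cubical face maps: `z ∘ s = id`. -/
theorem degenConnComposite_has_face_section {n m : ℕ}
    (z : (Fin n → Bool) → (Fin m → Bool)) (hz : IsDegenConnComposite z) :
    ∃ s : (Fin m → Bool) → (Fin n → Bool), IsFaceComposite s ∧ z ∘ s = id := by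
  induction hz with
  | id n => exact ⟨id, .id n, rfl⟩
  | degen f i _ ih =>
    exact exists_isFaceComposite_section_comp (cubeDegen_comp_cubeFace i false) ih
  | connPos f i _ ih =>
    exact exists_isFaceComposite_section_comp
      (cubeConn_comp_cubeFace (ε := false) (by decide) i) ih
  | connNeg f i _ ih =>
    exact exists_isFaceComposite_section_comp
      (cubeConn_comp_cubeFace (ε := true) (by decide) i) ih
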